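/- arXiv:1804.08176 — 2 statements merged into one kernel-verified Lean document; each statement's English description precedes it below -/
import Mathlib

section
/- There is an absolute constant C > 0 such that the following holds. Let p be a prime, let n, d, m ≥ 1, let ε ∈ (0, 1/3], let f : {0,1}^n → {0,1}, and let F_1, …, F_m be polynomials over 𝔽_p of degree at most d, each taking values in {0,1} ⊆ 𝔽_p on every point of {0,1}^n, together with nonnegative weights ν_1, …, ν_m summing to 1 such that for every x ∈ {0,1}^n, ∑_{i : F_i(x) ≠ f(x)} ν_i ≤ ε. Then there exists a torus polynomial of degree at most C·d·(log n + log(1/ε) + 1) that 3ε-approximates f. -/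
open Finset

noncomputable section

/-- The one-dimensional torus `ℝ/ℤ`. -/
abbrev 𝕋 := AddCircle (1 : ℝ)

/-- Real value of a Boolean input bit. -/
def bval {n : ℕ} (x : Fin n → Bool) (i : Fin n) : ℝ := if x i then 1 else 0

/-- Hamming weight of a Boolean input. -/
def wt {n : ℕ} (x : Fin n → Bool) : ℕ := ∑ i, if x i then 1 else 0

/-- `P` is a torus polynomial of degree at most `d` in `n` variables. -/
def IsTorusPoly {n : ℕ} (d : ℕ) (P : (Fin n → Bool) → 𝕋) : Prop :=
  ∃ c : Finset (Fin n) → ℝ, (∀ S, d < S.card → c S = 0) ∧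
    ∀ x, P x = ((∑ S : Finset (Fin n), c S * ∏ i ∈ S, bval x i : ℝ) : 𝕋)

/-- `P` ε-approximates the Boolean function `f`. -/
def Approx {n : ℕ} (P : (Fin n → Bool) → 𝕋) (f : (Fin n → Bool) → Bool) (ε : ℝ) : Prop :=
  ∀ x, ‖P x - (((if f x then 1 else 0) / 2 : ℝ) : 𝕋)‖ ≤ ε

/-- The sum of the upper half of the binomial expansion of `(a + (1 - a)) ^ (2 * k - 1)`. -/
def amplify {R : Type*} [CommRing R] (k : ℕ) (a : R) : R :=
  ∑ j ∈ Ico k (2 * k), ((2 * k - 1).choose j : R) * (a ^ j * (1 - a) ^ (2 * k - 1 - j))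

theorem map_amplify {R S : Type*} [CommRing R] [CommRing S] (φ : R →+* S) (k : ℕ) (a : R) :
    φ (amplify k a) = amplify k (φ a) := by
  simp [amplify]

theorem pow_dvd_amplify {R : Type*} [CommRing R] (k : ℕ) {p a : R} (h : p ∣ a) :
    p ^ k ∣ amplify k a := by
  refine dvd_sum fun j hj => ?_
  have hj' : k ≤ j := (mem_Ico.mp hj).1
  exact Dvd.dvd.mul_left (Dvd.dvd.mul_right ((pow_dvd_pow p hj').trans (pow_dvd_pow_of_dvd h j)) _) _

theorem pow_dvd_amplify_sub_one {R : Type*} [CommRing R] {k : ℕ} (hk : 1 ≤ k) {p a : R}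
    (h : p ∣ 1 - a) : p ^ k ∣ amplify k a - 1 := by
  have hsum : (∑ j ∈ range k,
      ((2 * k - 1).choose j : R) * (a ^ j * (1 - a) ^ (2 * k - 1 - j))) + amplify k a = 1 := by
    have h1 := add_pow a (1 - a) (2 * k - 1)
    rw [show 2 * k - 1 + 1 = 2 * k by omega] at h1
    rw [amplify, sum_range_add_sum_Ico _ (by omega : k ≤ 2 * k)]
    rw [add_sub_cancel, one_pow] at h1
    exact (sum_congr rfl fun j _ => by ring).trans h1.symm
  rw [show amplify k a - 1 = -∑ j ∈ range k,
      ((2 * k - 1).choose j : R) * (a ^ j * (1 - a) ^ (2 * k - 1 - j)) by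
    linear_combination hsum]
  refine (dvd_sum fun j hj => ?_).neg_right
  have hj' : k ≤ 2 * k - 1 - j := by have := mem_range.mp hj; omega
  exact Dvd.dvd.mul_left (Dvd.dvd.mul_left
    ((pow_dvd_pow p hj').trans (pow_dvd_pow_of_dvd h _)) _) _

theorem totalDegree_amplify_le {σ R : Type*} [CommRing R] (k d : ℕ) {G : MvPolynomial σ R}
    (hG : G.totalDegree ≤ d) : (amplify k G).totalDegree ≤ (2 * k - 1) * d := by
  refine MvPolynomial.totalDegree_finsetSum_le fun j hj => ?_
  have hj' := mem_Ico.mp hj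
  have h1 : (1 - G).totalDegree ≤ d :=
    (MvPolynomial.totalDegree_sub _ _).trans (by simpa using hG)
  calc _ ≤ ((2 * k - 1).choose j : MvPolynomial σ R).totalDegree
          + (G ^ j * (1 - G) ^ (2 * k - 1 - j)).totalDegree := MvPolynomial.totalDegree_mul _ _
    _ ≤ 0 + (j * d + (2 * k - 1 - j) * d) := by
      refine add_le_add ?_ ((MvPolynomial.totalDegree_mul _ _).trans (add_le_add ?_ ?_))
      · rw [← map_natCast (MvPolynomial.C : R →+* MvPolynomial σ R), MvPolynomial.totalDegree_C]
      · exact (MvPolynomial.totalDegree_pow _ _).trans (Nat.mul_le_mul_left _ hG)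
      · exact (MvPolynomial.totalDegree_pow _ _).trans (Nat.mul_le_mul_left _ h1)
    _ = (2 * k - 1) * d := by rw [zero_add, ← add_mul]; congr 1; omega

theorem exists_int_lift {σ : Type*} {p : ℕ} [NeZero p] (F : MvPolynomial σ (ZMod p)) :
    ∃ G : MvPolynomial σ ℤ, MvPolynomial.map (Int.castRingHom (ZMod p)) G = F ∧
      G.totalDegree ≤ F.totalDegree := by
  refine ⟨∑ s ∈ F.support, MvPolynomial.monomial s ((F.coeff s).val : ℤ), ?_, ?_⟩
  · rw [map_sum]
    conv_rhs => rw [F.as_sum]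
    refine sum_congr rfl fun s _ => ?_
    simp [MvPolynomial.map_monomial]
  · refine MvPolynomial.totalDegree_finsetSum_le fun s hs => ?_
    exact (MvPolynomial.totalDegree_monomial_le _ _).trans (MvPolynomial.le_totalDegree hs)

/-- An evaluation of a real polynomial on the Boolean cube is a torus polynomial. -/
theorem isTorusPoly_eval {n D : ℕ} (H : MvPolynomial (Fin n) ℝ) (hH : H.totalDegree ≤ D) :
    IsTorusPoly D fun x => ((MvPolynomial.eval (bval x) H : ℝ) : 𝕋) := by
  refine ⟨fun S => ∑ s ∈ H.support with s.support = S, H.coeff s, fun S hS => ?_, fun x => ?_⟩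
  · refine sum_eq_zero fun s hs => ?_
    obtain rfl := (mem_filter.mp hs).2
    have h1 : s.support.card ≤ s.sum fun _ e => e := by
      rw [card_eq_sum_ones]
      exact sum_le_sum fun i hi => Nat.one_le_iff_ne_zero.mpr (Finsupp.mem_support_iff.mp hi)
    have h2 := MvPolynomial.le_totalDegree (mem_filter.mp hs).1
    omega
  · refine congrArg ((↑) : ℝ → 𝕋) ?_
    rw [MvPolynomial.eval_eq, ← sum_fiberwise H.support (fun s => s.support)]
    refine sum_congr rfl fun S _ => ?_
    rw [sum_mul]
    refine sum_congr rfl fun s hs => ?_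
    obtain ⟨-, rfl⟩ := mem_filter.mp hs
    congr 1
    refine prod_congr rfl fun i hi => ?_
    have : s i ≠ 0 := Finsupp.mem_support_iff.mp hi
    by_cases hx : x i <;> simp [bval, hx, this]

theorem exists_le_of_sum_mul_le {ι : Type*} [Fintype ι] {ν a : ι → ℝ} {B : ℝ}
    (hν : ∀ i, 0 ≤ ν i) (hsum : ∑ i, ν i = 1) (h : ∑ i, ν i * a i ≤ B) : ∃ i, a i ≤ B := by
  by_contra! hc
  obtain ⟨i, -, hi⟩ : ∃ i ∈ univ, ν i ≠ 0 := exists_ne_zero_of_sum_ne_zero (by simp [hsum])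
  have : ∑ i, ν i * B < ∑ i, ν i * a i :=
    sum_lt_sum (fun j _ => mul_le_mul_of_nonneg_left (hc j).le (hν j))
      ⟨i, mem_univ i, mul_lt_mul_of_pos_left (hc i) (lt_of_le_of_ne (hν i) hi.symm)⟩
  rw [← sum_mul, hsum, one_mul] at this
  linarith

/-- Derandomized sampling: the exponential potential of the number of bad indices grows by a factor
of at most `1 + ε` per sample. -/
theorem exists_sample_potential_le {ι X : Type*} [Fintype ι] [Fintype X] (w : ι → X → Prop)
    [∀ i x, Decidable (w i x)] {ν : ι → ℝ} {ε : ℝ} (hν : ∀ i, 0 ≤ ν i) (hsum : ∑ i, ν i = 1)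
    (hw : ∀ x, ∑ i with w i x, ν i ≤ ε) (hε : 0 ≤ ε) (t : ℕ) :
    ∃ g : Fin t → ι, ∑ x, ∏ j, (if w (g j) x then (2 : ℝ) else 1)
      ≤ Fintype.card X * (1 + ε) ^ t := by
  induction t with
  | zero => exact ⟨Fin.elim0, by simp⟩
  | succ t ih =>
    obtain ⟨g, hg⟩ := ih
    obtain ⟨i, hi⟩ := exists_le_of_sum_mul_le (B := Fintype.card X * (1 + ε) ^ (t + 1))
      (a := fun i => ∑ x, (if w i x then (2 : ℝ) else 1) *
        ∏ j, (if w (g j) x then (2 : ℝ) else 1)) hν hsum (by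
      simp only [mul_sum]
      rw [sum_comm]
      calc _ ≤ ∑ x, (1 + ε) * ∏ j, (if w (g j) x then (2 : ℝ) else 1) := by
            refine sum_le_sum fun x _ => ?_
            simp only [← mul_assoc]
            rw [← sum_mul]
            refine mul_le_mul_of_nonneg_right ?_
              (prod_nonneg fun j _ => by split_ifs <;> norm_num)
            have : ∀ i, ν i * (if w i x then (2 : ℝ) else 1)
                = ν i + (if w i x then ν i else 0) := by
              intro i; split_ifs <;> ring
            simp only [this]
            rw [sum_add_distrib, hsum, ← sum_filter]
            linarith [hw x]
        _ ≤ (1 + ε) * (Fintype.card X * (1 + ε) ^ t) := by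
            rw [← mul_sum]
            exact mul_le_mul_of_nonneg_left hg (by linarith)
        _ = _ := by ring)
    exact ⟨Fin.cons i g, by simpa [Fin.prod_univ_succ] using hi⟩

theorem exists_sample_card_le {ι : Type*} [Fintype ι] {n : ℕ} (w : ι → (Fin n → Bool) → Prop)
    [∀ i x, Decidable (w i x)] {ν : ι → ℝ} {ε : ℝ} (hν : ∀ i, 0 ≤ ν i) (hsum : ∑ i, ν i = 1)
    (hw : ∀ x, ∑ i with w i x, ν i ≤ ε) (hε : 0 ≤ ε) (t : ℕ) :
    ∃ g : Fin t → ι, ∀ x, (#{j | w (g j) x} : ℝ) ≤ n + 2 * ε * t := by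
  obtain ⟨g, hg⟩ := exists_sample_potential_le w hν hsum hw hε t
  refine ⟨g, fun x => ?_⟩
  have h1 : ∏ j, (if w (g j) x then (2 : ℝ) else 1) ≤ 2 ^ n * (1 + ε) ^ t := by
    refine le_trans (single_le_sum (f := fun x => ∏ j, (if w (g j) x then (2 : ℝ) else 1))
      (fun y _ => prod_nonneg fun j _ => by split_ifs <;> norm_num) (mem_univ x)) (hg.trans ?_)
    simp
  rw [← prod_filter, prod_const] at h1
  have h2 := Real.log_le_log (by positivity) h1
  rw [Real.log_mul (by positivity) (by positivity), Real.log_pow, Real.log_pow,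
    Real.log_pow] at h2
  have h3 : Real.log (1 + ε) ≤ ε := by
    linarith [Real.log_le_sub_one_of_pos (by linarith : 0 < 1 + ε)]
  have h4 : (1 : ℝ) / 2 ≤ Real.log 2 := by linarith [Real.log_two_gt_d9]
  have h5 : (t : ℝ) * Real.log (1 + ε) ≤ t * (2 * ε * Real.log 2) :=
    mul_le_mul_of_nonneg_left (h3.trans (by nlinarith)) (by positivity)
  refine le_of_mul_le_mul_right ?_ (by linarith : 0 < Real.log 2)
  linarith

/-- A power of `p` exceeding `B` whose exponent is logarithmic in `B`. -/
theorem exists_pow_ge {p : ℕ} (hp : 2 ≤ p) {B : ℝ} (hB : 1 < B) :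
    ∃ k : ℕ, 1 ≤ k ∧ B ≤ (p : ℝ) ^ k ∧ ((k - 1 : ℕ) : ℝ) ≤ 2 * Real.log B := by
  have hp' : (2 : ℝ) ≤ p := by exact_mod_cast hp
  obtain ⟨k, hk1, hk2⟩ := exists_nat_pow_near hB.le (by linarith : (1 : ℝ) < p)
  refine ⟨k + 1, by omega, hk2.le, ?_⟩
  have h1 : (2 : ℝ) ^ k ≤ B := (pow_le_pow_left₀ (by norm_num) hp' k).trans hk1
  have h2 := Real.log_le_log (by positivity) h1
  rw [Real.log_pow] at h2
  have h4 : (1 : ℝ) / 2 ≤ Real.log 2 := by linarith [Real.log_two_gt_d9]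
  have h5 : (0 : ℝ) ≤ k := by positivity
  simp only [Nat.add_sub_cancel]
  nlinarith

theorem norm_coe_sub_le_of_dvd {H c : ℤ} {q : ℕ} (hq : 0 < q) (h : (q : ℤ) ∣ H - c) (r : ℝ) :
    ‖(((H : ℝ) / q : ℝ) : 𝕋) - (r : 𝕋)‖ ≤ |(c : ℝ) / q - r| := by
  obtain ⟨z, hz⟩ := h
  have hq' : (q : ℝ) ≠ 0 := by positivity
  have hH : (H : ℝ) / q = (c : ℝ) / q + z := by
    have : (H : ℝ) = c + q * z := by exact_mod_cast (by linarith : H = c + q * z)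
    rw [this]; field_simp
  have hz : (((z : ℤ) : ℝ) : 𝕋) = 0 := (AddCircle.coe_eq_zero_iff 1).mpr ⟨z, by simp⟩
  rw [hH, AddCircle.coe_add, hz, add_zero, ← AddCircle.coe_sub]
  exact QuotientAddGroup.norm_mk_le_norm

/-- probabilistic polynomials over `𝔽_p` yield torus polynomial approximations
of degree `O(d·(log n + log(1/ε) + 1))`. -/
theorem stmt_2 : ∃ C : ℝ, 0 < C ∧
    ∀ (p n d m : ℕ), p.Prime → 1 ≤ n → 1 ≤ d → 1 ≤ m →
    ∀ ε : ℝ, 0 < ε → ε ≤ 1 / 3 →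
    ∀ f : (Fin n → Bool) → Bool,
    ∀ F : Fin m → MvPolynomial (Fin n) (ZMod p),
    (∀ i, (F i).totalDegree ≤ d) →
    (∀ i (x : Fin n → Bool),
      MvPolynomial.eval (fun j => if x j then (1 : ZMod p) else 0) (F i) = 0 ∨
      MvPolynomial.eval (fun j => if x j then (1 : ZMod p) else 0) (F i) = 1) →
    ∀ ν : Fin m → ℝ, (∀ i, 0 ≤ ν i) → (∑ i, ν i) = 1 →
    (∀ x : Fin n → Bool,
      ∑ i ∈ univ.filter (fun i =>
        MvPolynomial.eval (fun j => if x j then (1 : ZMod p) else 0) (F i)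
          ≠ (if f x then 1 else 0)), ν i ≤ ε) →
    ∃ D : ℕ, (D : ℝ) ≤ C * d * (Real.log n + Real.log (1 / ε) + 1) ∧
      ∃ P : (Fin n → Bool) → 𝕋, IsTorusPoly D P ∧ Approx P f (3 * ε) := by
  refine ⟨4, by norm_num, fun p n d m hp hn hd _ ε hε hε3 f F hdeg h01 ν hν hsum herr => ?_⟩
  have : NeZero p := ⟨hp.ne_zero⟩
  have : Fact p.Prime := ⟨hp⟩
  have hn' : (1 : ℝ) ≤ n := by exact_mod_cast hn
  have hd' : (1 : ℝ) ≤ d := by exact_mod_cast hd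
  have hB : 1 < (n : ℝ) / ε := by rw [lt_div_iff₀ hε]; linarith
  obtain ⟨k, hk, hkq, hklog⟩ := exists_pow_ge hp.two_le hB
  obtain ⟨q, hq⟩ : ∃ q : ℕ, q = p ^ k := ⟨_, rfl⟩
  have hqZ : (q : ℤ) = (p : ℤ) ^ k := by rw [hq]; push_cast; rfl
  have hqpos : 0 < q := hq ▸ pow_pos hp.pos k
  have hqR : (0 : ℝ) < q := by exact_mod_cast hqpos
  have hqn : (n : ℝ) ≤ ε * q := by
    rw [div_le_iff₀ hε] at hkq
    rw [hq]; push_cast; linarith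
  obtain ⟨t, ht1, ht2⟩ : ∃ t : ℕ, (2 : ℝ) * t ≤ q ∧ (q : ℝ) ≤ 2 * t + 1 :=
    ⟨q / 2, by exact_mod_cast (by omega : 2 * (q / 2) ≤ q),
      by exact_mod_cast (by omega : q ≤ 2 * (q / 2) + 1)⟩
  obtain ⟨g, hg⟩ := exists_sample_card_le _ hν hsum herr hε.le t
  choose G hGmap hGdeg using fun i => exists_int_lift (F i)
  refine ⟨(2 * k - 1) * d, ?_, fun x => ((MvPolynomial.eval (bval x)
    (MvPolynomial.C ((q : ℝ)⁻¹) * MvPolynomial.map (Int.castRingHom ℝ)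
      (∑ j, amplify k (G (g j)))) : ℝ) : 𝕋), isTorusPoly_eval _ ?_, fun x => ?_⟩
  · have h1 : Real.log ((n : ℝ) / ε) = Real.log n + Real.log (1 / ε) := by
      rw [← Real.log_mul (by positivity) (by positivity)]; congr 1; ring
    have h2 : ((2 * k - 1 : ℕ) : ℝ) = 2 * ((k - 1 : ℕ) : ℝ) + 1 := by
      exact_mod_cast (by omega : 2 * k - 1 = 2 * (k - 1) + 1)
    rw [h1] at hklog
    rw [Nat.cast_mul, h2]
    nlinarith
  · refine (MvPolynomial.totalDegree_mul _ _).trans ?_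
    rw [MvPolynomial.totalDegree_C, zero_add]
    refine (sup_mono (MvPolynomial.support_map_subset _ _)).trans
      (MvPolynomial.totalDegree_finsetSum_le fun j _ => ?_)
    exact totalDegree_amplify_le k d ((hGdeg _).trans (hdeg _))
  · obtain ⟨y, hy⟩ : ∃ y : Fin n → ℤ, y = fun i => if x i then 1 else 0 := ⟨_, rfl⟩
    have hbval : bval x = fun i => Int.castRingHom ℝ (y i) := by
      ext i; simp [hy, bval]
    have hev : MvPolynomial.eval (bval x) (MvPolynomial.C ((q : ℝ)⁻¹) *
        MvPolynomial.map (Int.castRingHom ℝ) (∑ j, amplify k (G (g j)))) =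
        ((∑ j, amplify k (MvPolynomial.eval y (G (g j))) : ℤ) : ℝ) / q := by
      have := MvPolynomial.map_eval (Int.castRingHom ℝ) y (∑ j, amplify k (G (g j)))
      rw [map_mul, MvPolynomial.eval_C, hbval]
      change _ * MvPolynomial.eval (Int.castRingHom ℝ ∘ y) _ = _
      rw [← this, map_sum]
      simp only [map_amplify, eq_intCast]
      rw [inv_mul_eq_div]
    have hFG : ∀ i, MvPolynomial.eval (fun j => if x j then (1 : ZMod p) else 0) (F i)
        = ((MvPolynomial.eval y (G i) : ℤ) : ZMod p) := by
      intro i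
      have := MvPolynomial.map_eval (Int.castRingHom (ZMod p)) y (G i)
      rw [hGmap, eq_intCast] at this
      rw [this]
      congr 2
      ext j; simp [hy]
    have hgx := hg x
    generalize hEdef : #{j | MvPolynomial.eval (fun j => if x j then (1 : ZMod p) else 0) (F (g j))
          ≠ (if f x then 1 else 0)} = E at hgx
    have hdvd : (q : ℤ) ∣ (∑ j, amplify k (MvPolynomial.eval y (G (g j)))) -
        (if f x then (t : ℤ) - E else E) := by
      have hcount : (if f x then (t : ℤ) - E else E) = ∑ j : Fin t,
          if MvPolynomial.eval (fun j => if x j then (1 : ZMod p) else 0) (F (g j)) = 1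
            then (1 : ℤ) else 0 := by
        have hEsum : (E : ℤ) = ∑ j : Fin t,
          if MvPolynomial.eval (fun j => if x j then (1 : ZMod p) else 0) (F (g j))
            ≠ (if f x then 1 else 0) then (1 : ℤ) else 0 := by
          rw [← hEdef, sum_boole]
        have hcard : (t : ℤ) = ∑ j : Fin t, 1 := by simp
        split_ifs with hf
        · rw [hEsum, hcard, ← sum_sub_distrib]
          refine sum_congr rfl fun j _ => ?_
          rcases h01 (g j) x with h | h <;> simp [h, hf]
        · rw [hEsum]
          refine sum_congr rfl fun j _ => ?_
          rcases h01 (g j) x with h | h <;> simp [h, hf]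
      rw [hcount, ← sum_sub_distrib, hqZ]
      refine dvd_sum fun j _ => ?_
      rcases h01 (g j) x with h | h
      · rw [if_neg (by simp [h]), sub_zero]
        rw [hFG] at h
        exact pow_dvd_amplify k ((ZMod.intCast_zmod_eq_zero_iff_dvd _ p).mp h)
      · rw [if_pos h]
        rw [hFG] at h
        refine pow_dvd_amplify_sub_one hk ((ZMod.intCast_zmod_eq_zero_iff_dvd _ p).mp ?_)
        simp [h]
    simp only [hev]
    refine (norm_coe_sub_le_of_dvd hqpos hdvd _).trans ?_
    have hE0 : (0 : ℝ) ≤ E := by positivity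
    have hEq : (E : ℝ) ≤ n + ε * q := by nlinarith
    clear hdvd hev hg herr hEdef
    split_ifs with hf
    · rw [Int.cast_sub, Int.cast_natCast, Int.cast_natCast, div_sub_div _ _ hqR.ne' two_ne_zero,
        abs_div, abs_of_pos (by positivity : (0 : ℝ) < q * 2), div_le_iff₀ (by positivity), abs_le]
      constructor <;> nlinarith
    · rw [Int.cast_natCast, zero_div, sub_zero, abs_of_nonneg (by positivity), div_le_iff₀ hqR]
      nlinarith
end
end

section
/- Let n ≥ 1 and d ≥ 0 be integers. If there exists a symmetric torus polynomial in 2n+1 variables of degree at most d that (1/(40n))-approximates Maj_{2n+1}, then for every integer w with 0 ≤ w ≤ n there exists a symmetric torus polynomial in n variables of degree at most d that (1/(20n))-approximates Δ_w. -/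
open Finset

noncomputable section

/-- \`P\` is a symmetric torus polynomial of degree at most \`d\` in \`n\` variables:
\`P(x) = ∑_{j=0}^d c_j (x_1 + ⋯ + x_n)^j (mod 1)\`. -/
def IsSymTorusPoly {n : ℕ} (d : ℕ) (P : (Fin n → Bool) → 𝕋) : Prop :=
  ∃ c : ℕ → ℝ, ∀ x, P x = ((∑ j ∈ Finset.range (d + 1), c j * (wt x : ℝ) ^ j : ℝ) : 𝕋)

/-- The delta function \`Δ_w\`: value 1 exactly on inputs of Hamming weight \`w\`. -/
def delta {n : ℕ} (w : ℕ) (x : Fin n → Bool) : Bool := decide (wt x = w)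

/-- MAJORITY on \`m\` bits: value 1 exactly on inputs of Hamming weight at least \`m/2\`. -/
def maj {m : ℕ} (x : Fin m → Bool) : Bool := decide (m ≤ 2 * wt x)

theorem wt_le {n : ℕ} (x : Fin n → Bool) : wt x ≤ n := by
  unfold wt
  calc ∑ i, (if x i then 1 else 0) ≤ ∑ _i : Fin n, 1 :=
        Finset.sum_le_sum fun i _ => by split <;> simp
    _ = n := by simp

theorem exists_wt_eq {n k : ℕ} (hk : k ≤ n) : ∃ x : Fin n → Bool, wt x = k := by
  refine ⟨fun i => decide ((i : ℕ) < k), ?_⟩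
  simp only [wt, decide_eq_true_eq]
  rw [Fin.sum_univ_eq_sum_range (fun i => if i < k then 1 else 0) n, Finset.sum_boole]
  have : (Finset.range n).filter (· < k) = Finset.range k := by
    ext i
    simp only [Finset.mem_filter, Finset.mem_range]
    omega
  simp [this]

open Polynomial in
/-- The forward difference, at a shifted argument, of a polynomial function of degree at most `d`
is again a polynomial function of degree at most `d`. -/
theorem exists_coeff_shift_sub (d : ℕ) (c : ℕ → ℝ) (a : ℝ) :
    ∃ c' : ℕ → ℝ, ∀ t : ℝ, ∑ j ∈ Finset.range (d + 1), c' j * t ^ j =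
      (∑ j ∈ Finset.range (d + 1), c j * (t + (a + 1)) ^ j) -
        ∑ j ∈ Finset.range (d + 1), c j * (t + a) ^ j := by
  set p : ℝ[X] := ∑ j ∈ Finset.range (d + 1), C (c j) * X ^ j with hp
  have hdeg : p.natDegree ≤ d :=
    natDegree_sum_le_of_forall_le _ _ fun j hj =>
      (natDegree_C_mul_X_pow_le _ _).trans (Nat.lt_succ_iff.mp (Finset.mem_range.mp hj))
  have heval (t : ℝ) : p.eval t = ∑ j ∈ Finset.range (d + 1), c j * t ^ j := by
    simp [hp, eval_finsetSum]
  have hcomp (b : ℝ) : (p.comp (X + C b)).natDegree ≤ d := by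
    simpa [natDegree_comp] using hdeg
  refine ⟨(p.comp (X + C (a + 1)) - p.comp (X + C a)).coeff, fun t => ?_⟩
  have hlt : (p.comp (X + C (a + 1)) - p.comp (X + C a)).natDegree < d + 1 :=
    Nat.lt_succ_of_le ((natDegree_sub_le_of_le (hcomp _) (hcomp _)).trans (max_self d).le)
  rw [← eval_eq_sum_range' hlt]
  simp only [eval_sub, eval_comp, eval_add, eval_X, eval_C, heval]

/-- from a symmetric torus polynomial of degree ≤ d in `2n+1` variables
`1/(40n)`-approximating `Maj_{2n+1}`, one obtains, for every `0 ≤ w ≤ n`, a symmetric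
torus polynomial of degree ≤ d in `n` variables `1/(20n)`-approximating `Δ_w`. -/
theorem stmt_8 (n d : ℕ) (hn : 1 ≤ n)
    (h : ∃ P : (Fin (2 * n + 1) → Bool) → 𝕋,
      IsSymTorusPoly d P ∧ Approx P maj (1 / (40 * n))) :
    ∀ w : ℕ, w ≤ n → ∃ P : (Fin n → Bool) → 𝕋,
      IsSymTorusPoly d P ∧ Approx P (delta w) (1 / (20 * n)) := by
  obtain ⟨P, ⟨c, hc⟩, hP⟩ := h
  intro w hw
  obtain ⟨c', hc'⟩ := exists_coeff_shift_sub d c ((n - w : ℕ) : ℝ)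
  refine ⟨fun x => ((∑ j ∈ Finset.range (d + 1), c' j * (wt x : ℝ) ^ j : ℝ) : 𝕋),
    ⟨c', fun _ => rfl⟩, fun x => ?_⟩
  have hx := wt_le x
  obtain ⟨y, hy⟩ := exists_wt_eq (n := 2 * n + 1) (k := wt x + ((n - w) + 1)) (by omega)
  obtain ⟨z, hz⟩ := exists_wt_eq (n := 2 * n + 1) (k := wt x + (n - w)) (by omega)
  have hQ : ((∑ j ∈ Finset.range (d + 1), c' j * (wt x : ℝ) ^ j : ℝ) : 𝕋) = P y - P z := by
    rw [hc y, hc z, hc', hy, hz, AddCircle.coe_sub]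
    push_cast
    rfl
  have hf : (((if delta w x then 1 else 0) / 2 : ℝ) : 𝕋) =
      (((if maj y then 1 else 0) / 2 : ℝ) : 𝕋) - (((if maj z then 1 else 0) / 2 : ℝ) : 𝕋) := by
    rw [← AddCircle.coe_sub]
    congr 1
    simp only [delta, maj, hy, hz, decide_eq_true_eq]
    split_ifs <;> first | omega | norm_num
  simp only [hQ, hf]
  rw [sub_sub_sub_comm]
  calc _ ≤ _ := norm_sub_le _ _
    _ ≤ 1 / (40 * (n : ℝ)) + 1 / (40 * n) := add_le_add (hP y) (hP z)
    _ = 1 / (20 * n) := by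
      have : (n : ℝ) ≠ 0 := by positivity
      field_simp
      norm_num
end
end
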